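/- Let n be odd and F : F_{2^n} → F_{2^n} be a bijective almost bent function. Then the set S_F = {(x, F(x)) : x ∈ F_{2^n}} is formally self dual under the trace pairing ⟨(x,y),(a,b)⟩ = (−1)^{Tr(ax+by)} if and only if for all a, b ∈ F_{2^n}: δ_F(a,b) = 0 ⟺ W_F(a,b) = 0. -/

import Mathlib

open scoped Classical

/-- The sign `(−1)^{Tr(t)} ∈ ℤ`, with `Tr` the absolute trace of `F_{2^n}`. -/
noncomputable def sgn {n : ℕ} (t : GaloisField 2 n) : ℤ :=
  (-1) ^ (Algebra.trace (ZMod 2) (GaloisField 2 n) t).val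

/-- The weight enumerator `ν_S(a,b) = #{(u,v) ∈ S×S : u − v = (a,b)}`. -/
noncomputable def nu2 {n : ℕ} (S : Set (GaloisField 2 n × GaloisField 2 n))
    (g : GaloisField 2 n × GaloisField 2 n) : ℕ :=
  Nat.card {q : (GaloisField 2 n × GaloisField 2 n) × (GaloisField 2 n × GaloisField 2 n) //
    q.1 ∈ S ∧ q.2 ∈ S ∧ q.1 - q.2 = g}

/-- `S ⊆ F_{2^n} × F_{2^n}` is formally self dual under the trace pairing
`⟨(x,y),(a,b)⟩ = (−1)^{Tr(ax+by)}`. -/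
noncomputable def FSDTrace {n : ℕ} (S : Set (GaloisField 2 n × GaloisField 2 n)) : Prop :=
  ∀ a b : GaloisField 2 n,
    (∑ᶠ s ∈ S, sgn (a * s.1 + b * s.2)) ^ 2 = (Nat.card S : ℤ) * nu2 S (a, b)

/-- The graph `S_F = {(x, F(x)) : x ∈ F_{2^n}}`. -/
def graphSet {n : ℕ} (F : GaloisField 2 n → GaloisField 2 n) :
    Set (GaloisField 2 n × GaloisField 2 n) :=
  {q | ∃ x : GaloisField 2 n, q = (x, F x)}

/-- `δ_F(a,b) = #{x : F(x+a) + F(x) = b}`. -/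
noncomputable def deltaF {n : ℕ} (F : GaloisField 2 n → GaloisField 2 n)
    (a b : GaloisField 2 n) : ℕ :=
  Nat.card {x : GaloisField 2 n // F (x + a) + F x = b}

/-- The Walsh transform `W_F(a,b) = ∑_x (−1)^{Tr(bF(x)+ax)}`. -/
noncomputable def walsh {n : ℕ} (F : GaloisField 2 n → GaloisField 2 n)
    (a b : GaloisField 2 n) : ℤ :=
  ∑ᶠ x : GaloisField 2 n, sgn (b * F x + a * x)

variable {n : ℕ}

theorem sgn_zero : sgn (0 : GaloisField 2 n) = 1 := by simp [sgn]

theorem sgn_add (s t : GaloisField 2 n) : sgn (s + t) = sgn s * sgn t := by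
  unfold sgn
  rw [map_add]
  generalize Algebra.trace (ZMod 2) (GaloisField 2 n) s = u
  generalize Algebra.trace (ZMod 2) (GaloisField 2 n) t = v
  revert u v
  decide

theorem exists_sgn_eq_neg_one : ∃ t : GaloisField 2 n, sgn t = -1 := by
  obtain ⟨t, ht⟩ := Algebra.trace_surjective (ZMod 2) (GaloisField 2 n) 1
  exact ⟨t, by rw [sgn, ht]; decide⟩

noncomputable instance : Fintype (GaloisField 2 n) := Fintype.ofFinite _

theorem sum_sgn_mul_eq_zero {t : GaloisField 2 n} (ht : t ≠ 0) :
    ∑ a : GaloisField 2 n, sgn (a * t) = 0 := by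
  obtain ⟨c, hc⟩ := exists_sgn_eq_neg_one (n := n)
  have h := Equiv.sum_comp (Equiv.addRight (c / t)) fun a : GaloisField 2 n => sgn (a * t)
  simp only [Equiv.coe_addRight, add_mul, div_mul_cancel₀ _ ht, sgn_add, hc,
    ← Finset.sum_mul] at h
  linarith

theorem walsh_eq_sum (F : GaloisField 2 n → GaloisField 2 n) (a b : GaloisField 2 n) :
    walsh F a b = ∑ x, sgn (b * F x + a * x) := finsum_eq_sum_of_fintype _

theorem deltaF_eq_card (F : GaloisField 2 n → GaloisField 2 n) (a b : GaloisField 2 n) :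
    deltaF F a b = (Finset.univ.filter fun x => F (x + a) + F x = b).card := by
  rw [deltaF, Nat.card_eq_fintype_card, Fintype.card_subtype]

/-- Parseval's identity for the Walsh transform in its first argument. -/
theorem sum_walsh_sq (F : GaloisField 2 n → GaloisField 2 n) (b : GaloisField 2 n) :
    ∑ a, walsh F a b ^ 2 = (Fintype.card (GaloisField 2 n) : ℤ) ^ 2 := by
  have expand (a : GaloisField 2 n) :
      walsh F a b ^ 2 = ∑ x, ∑ y, sgn (b * (F x + F y)) * sgn (a * (x + y)) := by
    rw [walsh_eq_sum, sq, Finset.sum_mul_sum]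
    refine Finset.sum_congr rfl fun x _ => Finset.sum_congr rfl fun y _ => ?_
    rw [← sgn_add, ← sgn_add]
    congr 1
    ring
  have inner (x y : GaloisField 2 n) :
      ∑ a, sgn (b * (F x + F y)) * sgn (a * (x + y)) =
        if x = y then (Fintype.card (GaloisField 2 n) : ℤ) else 0 := by
    rw [← Finset.mul_sum]
    split_ifs with h
    · subst h
      simp [CharTwo.add_self_eq_zero, sgn_zero]
    · rw [sum_sgn_mul_eq_zero (mt CharTwo.add_eq_zero.mp h), mul_zero]
  simp_rw [expand]
  rw [Finset.sum_comm]
  simp_rw [Finset.sum_comm (s := Finset.univ (α := GaloisField 2 n)) (t := Finset.univ)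
    (f := fun a y => sgn (b * (F _ + F y)) * sgn (a * (_ + y))), inner]
  simp [sq]

/-- For bijective `F`, the derivative counts with prescribed output difference sum to `2 ^ n`. -/
theorem sum_deltaF {F : GaloisField 2 n → GaloisField 2 n} (hF : Function.Bijective F)
    (b : GaloisField 2 n) : ∑ a, deltaF F a b = Fintype.card (GaloisField 2 n) := by
  simp_rw [deltaF_eq_card, Finset.card_filter]
  rw [Finset.sum_comm, ← Finset.card_univ, Finset.card_eq_sum_ones]
  refine Finset.sum_congr rfl fun x _ => ?_
  obtain ⟨y, hy⟩ := hF.2 (b + F x)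
  rw [Finset.sum_eq_single (y + x)]
  · rw [if_pos]
    rw [add_comm y x, ← add_assoc, CharTwo.add_self_eq_zero, zero_add, hy, add_assoc,
      CharTwo.add_self_eq_zero, add_zero]
  · intro a _ ha
    rw [if_neg]
    intro h
    apply ha
    have : x + a = y := hF.1 (by rw [hy, ← h, add_assoc, CharTwo.add_self_eq_zero, add_zero])
    rw [← this, add_comm x a, add_assoc, CharTwo.add_self_eq_zero, add_zero]
  · simp

theorem two_le_deltaF (F : GaloisField 2 n → GaloisField 2 n) {a b : GaloisField 2 n}
    (hb : b ≠ 0) (h : deltaF F a b ≠ 0) : 2 ≤ deltaF F a b := by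
  rw [deltaF_eq_card] at h ⊢
  obtain ⟨x, hx⟩ := Finset.card_ne_zero.mp h
  have hx' : F (x + a) + F x = b := by simpa using hx
  refine Finset.one_lt_card.mpr ⟨x, hx, x + a, ?_, ?_⟩
  · simp [add_assoc, CharTwo.add_self_eq_zero, ← hx', add_comm (F x)]
  · intro hxa
    rw [← hxa, CharTwo.add_self_eq_zero] at hx'
    exact hb hx'.symm

theorem finsum_graphSet (F : GaloisField 2 n → GaloisField 2 n) (a b : GaloisField 2 n) :
    ∑ᶠ s ∈ graphSet F, sgn (a * s.1 + b * s.2) = walsh F a b := by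
  have h : graphSet F = Set.range fun x => (x, F x) := by
    ext q
    simp [graphSet, eq_comm]
  rw [h, finsum_mem_range fun x y hxy => congrArg Prod.fst hxy, walsh]
  simp_rw [add_comm]

theorem natCard_graphSet (F : GaloisField 2 n → GaloisField 2 n) :
    Nat.card (graphSet F) = Fintype.card (GaloisField 2 n) := by
  have h : graphSet F = Set.range fun x => (x, F x) := by
    ext q
    simp [graphSet, eq_comm]
  rw [h, Nat.card_range_of_injective fun x y hxy => congrArg Prod.fst hxy,
    Nat.card_eq_fintype_card]

theorem nu2_graphSet (F : GaloisField 2 n → GaloisField 2 n) (a b : GaloisField 2 n) :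
    nu2 (graphSet F) (a, b) = deltaF F a b := by
  refine (Nat.card_congr (Equiv.ofBijective
    (fun x : {x // F (x + a) + F x = b} => ⟨((x.1 + a, F (x.1 + a)), (x.1, F x.1)),
      ⟨_, rfl⟩, ⟨_, rfl⟩, by simp [CharTwo.sub_eq_add (F _), x.2]⟩) ⟨?_, ?_⟩)).symm
  · intro x y h
    simp only [Subtype.mk.injEq, Prod.mk.injEq] at h
    exact Subtype.ext h.2.1
  · rintro ⟨⟨u, v⟩, ⟨x, hx⟩, ⟨y, hy⟩, h⟩
    simp only at hx hy h
    subst hx hy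
    simp only [Prod.mk_sub_mk, Prod.mk.injEq] at h
    obtain ⟨h₁, h₂⟩ := h
    have hxy : x = y + a := by rw [← h₁]; ring
    subst hxy
    exact ⟨⟨y, by rw [← h₂, CharTwo.sub_eq_add]⟩, rfl⟩

theorem fsdTrace_graphSet_iff (F : GaloisField 2 n → GaloisField 2 n) :
    FSDTrace (graphSet F) ↔
      ∀ a b, walsh F a b ^ 2 = (Fintype.card (GaloisField 2 n) : ℤ) * deltaF F a b := by
  simp only [FSDTrace, finsum_graphSet, natCard_graphSet, nu2_graphSet]

theorem walsh_sq_le {F : GaloisField 2 n → GaloisField 2 n} (hn : Odd n)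
    (hF : Function.Injective F)
    (hAB : ∀ a b : GaloisField 2 n, b ≠ 0 →
      walsh F a b = 0 ∨ walsh F a b = 2 ^ ((n + 1) / 2) ∨ walsh F a b = -2 ^ ((n + 1) / 2))
    (h : ∀ a b : GaloisField 2 n, deltaF F a b = 0 → walsh F a b = 0) (a b : GaloisField 2 n) :
    walsh F a b ^ 2 ≤ (Fintype.card (GaloisField 2 n) : ℤ) * deltaF F a b := by
  by_cases hd : deltaF F a b = 0
  · simp [h a b hd, hd]
  by_cases hb : b = 0
  · subst hb
    have ha : a = 0 := by
      rw [deltaF_eq_card] at hd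
      obtain ⟨x, hx⟩ := Finset.card_ne_zero.mp hd
      have hx' : F (x + a) + F x = 0 := by simpa using hx
      simpa using hF (CharTwo.add_eq_zero.mp hx')
    subst ha
    simp [walsh_eq_sum, deltaF_eq_card, sgn_zero, CharTwo.add_self_eq_zero, sq]
  · have hd2 : (2 : ℤ) ≤ deltaF F a b := by exact_mod_cast two_le_deltaF F hb hd
    have hcard : (Fintype.card (GaloisField 2 n) : ℤ) = 2 ^ n := by
      rw [← Nat.card_eq_fintype_card, GaloisField.card 2 n hn.pos.ne']
      norm_num
    have hpow : ((2 : ℤ) ^ ((n + 1) / 2)) ^ 2 = 2 ^ n * 2 := by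
      rw [← pow_mul, Nat.div_mul_cancel hn.add_one.two_dvd, pow_succ]
    have hle : (2 : ℤ) ^ n * 2 ≤ 2 ^ n * deltaF F a b := by gcongr
    rw [hcard]
    rcases hAB a b hb with hw | hw | hw <;> rw [hw]
    · simp only [ne_eq, OfNat.ofNat_ne_zero, not_false_eq_true, zero_pow]
      positivity
    · rwa [hpow]
    · rwa [neg_sq, hpow]

theorem stmt11 (n : ℕ) (hn : Odd n) (F : GaloisField 2 n → GaloisField 2 n)
    (hbij : Function.Bijective F)
    (hAB : ∀ a b : GaloisField 2 n, b ≠ 0 →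
      walsh F a b = 0 ∨ walsh F a b = 2 ^ ((n + 1) / 2) ∨ walsh F a b = -2 ^ ((n + 1) / 2)) :
    FSDTrace (graphSet F) ↔
      ∀ a b : GaloisField 2 n, (deltaF F a b = 0 ↔ walsh F a b = 0) := by
  rw [fsdTrace_graphSet_iff]
  constructor
  · intro h a b
    rw [← sq_eq_zero_iff (a := walsh F a b), h a b]
    simp
  · intro h a b
    refine (Finset.sum_eq_sum_iff_of_le fun a _ =>
      walsh_sq_le hn hbij.1 hAB (fun a b => (h a b).1) a b).mp ?_ a (Finset.mem_univ a)
    rw [sum_walsh_sq, ← Finset.mul_sum, ← Nat.cast_sum, sum_deltaF hbij, sq]
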